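/- For each pair of fixed integers S ≥ 0 and R ≥ d+1, there exist only finitely many (d+1)-colored graphs Γ (up to isomorphism) with Gurau degree ω_G(Γ) = S and with Σ_{i∈Δ_d} g_{î} = R, where g_{î} is the number of d-residues of Γ missing color i. -/

import Mathlib

open Relation

/-- An `n`-colored graph: a regular `n`-valent multigraph with a proper edge-coloring
by `Fin n`, encoded by one fixed-point-free "partner" involution per color. -/
structure CG (n : ℕ) where
  V : Type
  [finV : Fintype V]
  inv : Fin n → V → V
  invol : ∀ i v, inv i (inv i v) = v
  noFix : ∀ i v, inv i v ≠ v

attribute [instance] CG.finV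

namespace CG

variable {n : ℕ}

/-- `a` and `b` are joined by an edge whose color lies in `B`. -/
def step (G : CG n) (B : Set (Fin n)) (a b : G.V) : Prop := ∃ i ∈ B, G.inv i a = b

/-- `g_B`: the number of connected components of the subgraph spanned by the
edges with colors in `B`. -/
noncomputable def g (G : CG n) (B : Set (Fin n)) : ℕ :=
  Nat.card (Quotient (EqvGen.setoid (G.step B)))

def Connected (G : CG n) : Prop := ∀ a b : G.V, EqvGen (G.step Set.univ) a b

def Bipartite (G : CG n) : Prop := ∃ f : G.V → Bool, ∀ i v, f (G.inv i v) = ! f v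

/-- The `B`-residue containing `v` is bipartite. -/
def ResidueBipartite (G : CG n) (B : Set (Fin n)) (v : G.V) : Prop :=
  ∃ f : G.V → Bool, ∀ w, EqvGen (G.step B) v w → ∀ i ∈ B, f (G.inv i w) = ! f w

/-- Half the number of vertices, as a rational. -/
noncomputable def pQ (G : CG n) : ℚ := (Nat.card G.V : ℚ) / 2

/-- The regular genus of `G` with respect to the cyclic permutation `ε`:
`ρ_ε(Γ) = 1 - ½( Σ_j g_{ε_j ε_{j+1}} + (1-d)p )` where `n = d+1`. -/
noncomputable def rho [NeZero n] (G : CG n) (ε : ZMod n ≃ Fin n) : ℚ :=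
  1 - ((∑ j : ZMod n, (G.g {ε j, ε (j + 1)} : ℚ)) + (1 - ((n : ℚ) - 1)) * G.pQ) / 2

/-- The Gurau degree: the sum of `ρ_ε(Γ)` over all cyclic permutations of the colors
up to rotation and inversion; since `ρ_ε` is invariant under rotation and inversion of
`ε`, this is the sum over all `n!` labelings divided by `2n`. -/
noncomputable def omegaG [NeZero n] (G : CG n) : ℚ :=
  (∑ ε : ZMod n ≃ Fin n, G.rho ε) / (2 * n)

instance [NeZero n] : Nonempty (ZMod n ≃ Fin n) :=
  ⟨Fintype.equivOfCardEq (by simp [ZMod.card])⟩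

/-- The regular genus `ρ(Γ) = min_ε ρ_ε(Γ)`. -/
noncomputable def rhoMin [NeZero n] (G : CG n) : ℚ :=
  Finset.univ.inf' Finset.univ_nonempty (fun ε : ZMod n ≃ Fin n => G.rho ε)

/-- The residue (connected component) of the subgraph missing color `i` which
contains `v`, as an `n`-colored graph (colors renamed via `i.succAbove`). -/
noncomputable def hatRes (G : CG (n + 1)) (i : Fin (n + 1)) (v : G.V) : CG n where
  V := {w : G.V // EqvGen (G.step {j | j ≠ i}) v w}
  finV := Fintype.ofFinite _
  inv k w := ⟨G.inv (i.succAbove k) w.1,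
    (w.2.trans _ _ _ (EqvGen.rel _ _ ⟨i.succAbove k, Fin.succAbove_ne i k, rfl⟩))⟩
  invol := fun k w => Subtype.ext (G.invol _ _)
  noFix := fun k w h => G.noFix _ w.1 (congrArg Subtype.val h)

/-- `g_{î}`: the number of residues missing color `i`. -/
noncomputable def gHat (G : CG (n + 1)) (i : Fin (n + 1)) : ℕ := G.g {j | j ≠ i}

/-- `ω_G(Γ_{î})`: the sum of the Gurau degrees of the residues missing color `i`
(each component's degree is counted once: the contribution of each of its
vertices is divided by its cardinality). -/
noncomputable def omegaHat [NeZero n] (G : CG (n + 1)) (i : Fin (n + 1)) : ℚ :=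
  ∑ v : G.V, (G.hatRes i v).omegaG / (Nat.card (G.hatRes i v).V)

/-- `x`,`y` form a dipole of colors `C`: they are joined by edges of all colors in `C`
and lie in different components of the subgraph missing the colors of `C`. -/
def IsDipole (G : CG n) (C : Finset (Fin n)) (x y : G.V) : Prop :=
  (∀ c ∈ C, G.inv c x = y) ∧ ¬ EqvGen (G.step {j | j ∉ (C : Set (Fin n))}) x y

def HasDipole (G : CG n) (r : ℕ) : Prop :=
  ∃ C : Finset (Fin n), C.card = r ∧ ∃ x y, G.IsDipole C x y

/-- `G'` is obtained from `G` by eliminating the dipole `(C, x, y)`: the two vertices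
are deleted and the hanging edges are welded according to their colors. -/
def ElimDipole (G G' : CG n) (C : Finset (Fin n)) (x y : G.V) : Prop :=
  G.IsDipole C x y ∧ (∀ c ∉ C, G.inv c x ≠ y) ∧
  ∃ e : G'.V ≃ {v : G.V // v ≠ x ∧ v ≠ y},
    ∀ i w, (G.inv i (e w : G.V) = x → ((e (G'.inv i w)) : G.V) = G.inv i y) ∧
      (G.inv i (e w : G.V) = y → ((e (G'.inv i w)) : G.V) = G.inv i x) ∧
      (G.inv i (e w : G.V) ≠ x → G.inv i (e w : G.V) ≠ y →
        ((e (G'.inv i w)) : G.V) = G.inv i (e w : G.V))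

/-- Color-preserving isomorphism of colored graphs. -/
def Iso (G G' : CG n) : Prop :=
  ∃ e : G.V ≃ G'.V, ∀ i v, e (G.inv i v) = G'.inv i (e v)

/-- `G` is contracted (relative to a predicate recognizing the graphs that represent
the sphere): for every color `i` either `Γ_{î}` is connected or none of its
components represents a sphere. -/
def Contracted (G : CG (n + 1)) (IsSphereGraph : CG n → Prop) : Prop :=
  ∀ i : Fin (n + 1), G.gHat i = 1 ∨ ∀ v, ¬ IsSphereGraph (G.hatRes i v)

noncomputable def resSetoid (G : CG (n + 1)) (i : Fin (n + 1)) : Setoid G.V :=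
  EqvGen.setoid (G.step {j | j ≠ i})

/-- The number of singular residues missing color `i`. -/
noncomputable def singCount (G : CG (n + 1)) (IsSphereGraph : CG n → Prop)
    (i : Fin (n + 1)) : ℕ :=
  Nat.card {x : Quotient (G.resSetoid i) // ¬ IsSphereGraph (G.hatRes i x.out)}

/-- Color `i` is singular: some residue missing color `i` is not a sphere. -/
def SingColor (G : CG (n + 1)) (IsSphereGraph : CG n → Prop) (i : Fin (n + 1)) : Prop :=
  ∃ v, ¬ IsSphereGraph (G.hatRes i v)

end CG

namespace CG

/-- The type of `B`-residues. -/
abbrev Q {n : ℕ} (G : CG n) (B : Set (Fin n)) : Type := Quotient (EqvGen.setoid (G.step B))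

/-- The `B`-residue of a vertex. -/
def mkQ {n : ℕ} (G : CG n) (B : Set (Fin n)) (v : G.V) : G.Q B := Quotient.mk _ v

theorem mkQ_eq {n : ℕ} (G : CG n) (B : Set (Fin n)) (v w : G.V) :
    G.mkQ B v = G.mkQ B w ↔ EqvGen (G.step B) v w := Quotient.eq

theorem mkQ_inv {n : ℕ} (G : CG n) (B : Set (Fin n)) (v : G.V) (i : Fin n) (h : i ∈ B) :
    G.mkQ B (G.inv i v) = G.mkQ B v :=
  ((G.mkQ_eq B _ _).2 (EqvGen.rel _ _ ⟨i, h, rfl⟩)).symm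

theorem eqvGen_mono {n : ℕ} (G : CG n) {B C : Set (Fin n)} (h : B ⊆ C) {v w : G.V}
    (hv : EqvGen (G.step B) v w) : EqvGen (G.step C) v w :=
  by
  have hs : G.step B ≤ G.step C := fun _ _ ⟨i, hi, e⟩ => ⟨i, h hi, e⟩
  exact EqvGen.mono hs _ _ hv

/-- Functions on vertices constant along `B`-edges are constant on residues. -/
theorem const_of_step {n : ℕ} (G : CG n) {B : Set (Fin n)} {α : Type*} (f : G.V → α)
    (h : ∀ i ∈ B, ∀ v, f (G.inv i v) = f v) {v w : G.V} (hv : EqvGen (G.step B) v w) :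
    f v = f w := by
  induction hv with
  | rel x y h' => obtain ⟨i, hi, rfl⟩ := h'; exact (h i hi x).symm
  | refl x => rfl
  | symm x y _ ih => exact ih.symm
  | trans x y z _ _ ih1 ih2 => exact ih1.trans ih2

/-- The residue map for `B ⊆ C`. -/
def mapQ {n : ℕ} (G : CG n) {B C : Set (Fin n)} (h : B ⊆ C) : G.Q B → G.Q C :=
  Quotient.map' id (fun _ _ hv => G.eqvGen_mono h hv)

theorem mapQ_mk {n : ℕ} (G : CG n) {B C : Set (Fin n)} (h : B ⊆ C) (v : G.V) :
    G.mapQ h (G.mkQ B v) = G.mkQ C v := rfl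

theorem eqv_single {n : ℕ} (G : CG n) (a : Fin n) (v w : G.V) :
    EqvGen (G.step {a}) v w ↔ (w = v ∨ w = G.inv a v) := by
  constructor
  · intro h
    induction h with
    | rel x y h' => obtain ⟨i, hi, rfl⟩ := h'; right; rw [Set.mem_singleton_iff.1 hi]
    | refl x => left; rfl
    | symm x y _ ih =>
      rcases ih with rfl | rfl
      · left; rfl
      · right; rw [G.invol]
    | trans x y z _ _ ih1 ih2 =>
      rcases ih1 with rfl | rfl
      · exact ih2
      · rcases ih2 with rfl | rfl
        · right; rfl
        · left; rw [G.invol]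
  · rintro (rfl | rfl)
    · exact EqvGen.refl _
    · exact EqvGen.rel _ _ ⟨a, rfl, rfl⟩

theorem two_mul_g_single {n : ℕ} (G : CG n) (a : Fin n) : 2 * G.g {a} = Nat.card G.V := by
  classical
  have h1 : G.g {a} = Fintype.card (G.Q {a}) := Nat.card_eq_fintype_card
  rw [h1, Nat.card_eq_fintype_card, ← Finset.card_univ, ← Finset.card_univ,
    Finset.card_eq_sum_card_fiberwise (f := G.mkQ {a}) (t := Finset.univ) (fun _ _ => by simp)]
  rw [Finset.sum_const_nat (m := 2), mul_comm]
  intro q _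
  obtain ⟨v, rfl⟩ : ∃ v, G.mkQ {a} v = q := Quotient.exists_rep q
  have : (Finset.univ.filter fun w => G.mkQ {a} w = G.mkQ {a} v) = {v, G.inv a v} := by
    ext w
    rw [Finset.mem_filter, eq_comm, mkQ_eq, eqv_single]
    simp
  rw [this, Finset.card_pair (G.noFix a v).symm]

section chain
variable {n m : ℕ} [NeZero m] (G : CG n) (τ : ZMod m → Fin n)

/-- Edges of the surface. -/
abbrev Ed : Type := Σ j : ZMod m, G.Q {τ j}
/-- Faces of the surface. -/
abbrev Fa : Type := Σ j : ZMod m, G.Q {τ j, τ (j + 1)}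

theorem sub1 (j : ZMod m) : ({τ j} : Set (Fin n)) ⊆ {τ j, τ (j + 1)} := by
  intro x hx; left; exact hx

theorem sub2 (j : ZMod m) : ({τ j} : Set (Fin n)) ⊆ {τ (j - 1), τ (j - 1 + 1)} := by
  intro x hx; right; rw [sub_add_cancel]; exact hx

/-- The boundary map on edges. -/
def bd1 : (G.Ed τ → ZMod 2) →ₗ[ZMod 2] (G.V → ZMod 2) where
  toFun h v := ∑ j : ZMod m, h ⟨j, G.mkQ _ v⟩
  map_add' h k := by funext v; simp [Finset.sum_add_distrib]
  map_smul' c h := by funext v; simp [Finset.mul_sum]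

/-- The boundary map on faces. -/
def bd2 : (G.Fa τ → ZMod 2) →ₗ[ZMod 2] (G.Ed τ → ZMod 2) where
  toFun a e := a ⟨e.1 - 1, G.mapQ (sub2 τ e.1) e.2⟩ + a ⟨e.1, G.mapQ (sub1 τ e.1) e.2⟩
  map_add' h k := by funext v; simp; ring
  map_smul' c h := by funext v; simp; ring

/-- Pullback of functions on components to faces. -/
def pull : (G.Q (Set.range τ) → ZMod 2) →ₗ[ZMod 2] (G.Fa τ → ZMod 2) :=
  LinearMap.funLeft _ _ (fun f : G.Fa τ => G.mapQ (C := Set.range τ)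
    (by rintro x (rfl | rfl) <;> exact ⟨_, rfl⟩) f.2)

theorem bd_comp : LinearMap.range (bd2 G τ) ≤ LinearMap.ker (bd1 G τ) := by
  rintro _ ⟨a, rfl⟩
  rw [LinearMap.mem_ker]
  funext v
  change ∑ j : ZMod m, (a ⟨j - 1, G.mkQ _ v⟩ + a ⟨j, G.mkQ _ v⟩) = 0
  rw [Finset.sum_add_distrib]
  have := Equiv.sum_comp (Equiv.subRight (1 : ZMod m))
    (fun j => a ⟨j, G.mkQ {τ j, τ (j + 1)} v⟩)
  change ∑ j : ZMod m, a ⟨j - 1, G.mkQ _ v⟩ = _ at this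
  rw [this]
  exact CharTwo.add_self_eq_zero _

theorem ker_bd2 : LinearMap.ker (bd2 G τ) ≤ LinearMap.range (pull G τ) := by
  intro a ha
  rw [LinearMap.mem_ker] at ha
  have h1 : ∀ (j : ZMod m) (v : G.V), a ⟨j - 1, G.mkQ _ v⟩ = a ⟨j, G.mkQ _ v⟩ := by
    intro j v
    have := congrFun ha ⟨j, G.mkQ _ v⟩
    change a ⟨j - 1, G.mkQ _ v⟩ + a ⟨j, G.mkQ _ v⟩ = 0 at this
    exact CharTwo.add_eq_zero.1 this
  have h2 : ∀ (k : ℕ) (v : G.V), a ⟨(k : ZMod m), G.mkQ _ v⟩ = a ⟨((0 : ℕ) : ZMod m), G.mkQ _ v⟩ := by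
    intro k v
    induction k with
    | zero => rfl
    | succ k ih =>
      rw [← h1, ← ih]
      have : ((k + 1 : ℕ) : ZMod m) - 1 = k := by push_cast; ring
      rw [this]
  have h3 : ∀ (j : ZMod m) (v : G.V), a ⟨j, G.mkQ _ v⟩ = a ⟨((0 : ℕ) : ZMod m), G.mkQ _ v⟩ := by
    intro j v
    have := h2 j.val v
    rwa [ZMod.natCast_zmod_val] at this
  refine ⟨Quotient.lift (fun v => a ⟨((0 : ℕ) : ZMod m), G.mkQ _ v⟩) ?_, ?_⟩
  · intro v w hvw
    refine G.const_of_step (B := Set.range τ) (fun v => a ⟨((0 : ℕ) : ZMod m), G.mkQ _ v⟩) ?_ hvw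
    rintro _ ⟨j, rfl⟩ v
    rw [← h3 j, ← h3 j, mkQ_inv]
    left; rfl
  · funext f
    obtain ⟨j, q⟩ := f
    obtain ⟨v, rfl⟩ : ∃ v, G.mkQ _ v = q := Quotient.exists_rep q
    exact (h3 j v).symm

theorem range_bd1 : Nat.card G.V ≤
    Module.finrank (ZMod 2) (LinearMap.range (bd1 G τ)) + G.g (Set.range τ) := by
  classical
  have hstep : ∀ v w, EqvGen (G.step (Set.range τ)) v w →
      (Pi.single v 1 - Pi.single w 1 : G.V → ZMod 2) ∈ LinearMap.range (bd1 G τ) := by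
    intro v w h
    induction h with
    | rel x y h' =>
      obtain ⟨_, ⟨j, rfl⟩, rfl⟩ := h'
      refine ⟨Pi.single ⟨j, G.mkQ _ x⟩ 1, ?_⟩
      funext u
      change ∑ i : ZMod m, (Pi.single (⟨j, G.mkQ _ x⟩ : G.Ed τ) 1 : G.Ed τ → ZMod 2)
        ⟨i, G.mkQ _ u⟩ = _
      rw [Finset.sum_eq_single j]
      · have hne := G.noFix (τ j) x
        have key : ((⟨j, G.mkQ {τ j} u⟩ : G.Ed τ) = ⟨j, G.mkQ _ x⟩) ↔
            (u = x ∨ u = G.inv (τ j) x) := by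
          rw [← eqv_single, ← mkQ_eq, eq_comm]
          simp
        rw [Pi.single_apply, Pi.sub_apply, Pi.single_apply, Pi.single_apply]
        simp only [key]
        by_cases h1 : u = x
        · subst h1
          simp [hne.symm]
        · by_cases h2 : u = G.inv (τ j) x
          · simp [h1, h2, hne, CharTwo.neg_eq]
          · simp [h1, h2]
      · intro i _ hi
        rw [Pi.single_apply, if_neg]
        intro h
        exact hi (congrArg Sigma.fst h)
      · simp
    | refl x => simp
    | symm x y _ ih => rw [← neg_sub]; exact Submodule.neg_mem _ ih
    | trans x y z _ _ ih1 ih2 =>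
      rw [← sub_add_sub_cancel _ (Pi.single y 1)]; exact Submodule.add_mem _ ih1 ih2
  let r : G.Q (Set.range τ) → (G.V → ZMod 2) := fun q => Pi.single q.out 1
  have htop : LinearMap.range (bd1 G τ) ⊔ Submodule.span (ZMod 2) (Set.range r) = ⊤ := by
    rw [eq_top_iff, ← (Pi.basisFun (ZMod 2) G.V).span_eq, Submodule.span_le]
    rintro _ ⟨v, rfl⟩
    rw [Pi.basisFun_apply]
    have : (Pi.single v 1 : G.V → ZMod 2) =
      (Pi.single v 1 - Pi.single (G.mkQ (Set.range τ) v).out 1) + r (G.mkQ _ v) := by simp [r]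
    rw [this]
    refine Submodule.add_mem_sup (hstep _ _ ?_) (Submodule.subset_span ⟨_, rfl⟩)
    rw [← mkQ_eq]
    exact (Quotient.out_eq _).symm
  have h1 := Submodule.finrank_add_le_finrank_add_finrank (LinearMap.range (bd1 G τ))
    (Submodule.span (ZMod 2) (Set.range r))
  rw [htop, finrank_top, Module.finrank_fintype_fun_eq_card] at h1
  have h2 := finrank_range_le_card (R := ZMod 2) r
  rw [Set.finrank] at h2
  have h3 : G.g (Set.range τ) = Fintype.card (G.Q (Set.range τ)) := Nat.card_eq_fintype_card
  rw [Nat.card_eq_fintype_card, h3]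
  omega

/-- Nonnegativity of the regular genus. -/
theorem genus_nonneg :
    2 * (∑ j : ZMod m, G.g {τ j, τ (j + 1)}) + 2 * Nat.card G.V ≤
      4 * G.g (Set.range τ) + m * Nat.card G.V := by
  classical
  have hE : 2 * Module.finrank (ZMod 2) (G.Ed τ → ZMod 2) = m * Nat.card G.V := by
    rw [Module.finrank_fintype_fun_eq_card, Fintype.card_sigma, Finset.mul_sum]
    have : ∀ j : ZMod m, 2 * Fintype.card (G.Q {τ j}) = Nat.card G.V := by
      intro j
      rw [← two_mul_g_single G (τ j), g, Nat.card_eq_fintype_card]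
    simp [this, ZMod.card]
  have hF : Module.finrank (ZMod 2) (G.Fa τ → ZMod 2) = ∑ j : ZMod m, G.g {τ j, τ (j + 1)} := by
    rw [Module.finrank_fintype_fun_eq_card, Fintype.card_sigma]
    simp [g, Nat.card_eq_fintype_card]
  have h1 := LinearMap.finrank_range_add_finrank_ker (bd2 G τ)
  have h2 := LinearMap.finrank_range_add_finrank_ker (bd1 G τ)
  have h3 := Submodule.finrank_mono (bd_comp G τ)
  have h4 := Submodule.finrank_mono (ker_bd2 G τ)
  have h5 := LinearMap.finrank_range_le (pull G τ)
  rw [Module.finrank_fintype_fun_eq_card] at h5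
  have h6 : G.g (Set.range τ) = Fintype.card (G.Q (Set.range τ)) := Nat.card_eq_fintype_card
  have h7 := range_bd1 G τ
  omega

end chain

/-- The cyclic sequence of colors obtained from `ε` by dropping `ε 0`. -/
def tau {d : ℕ} (ε : ZMod (d + 1) ≃ Fin (d + 1)) (k : ZMod d) : Fin (d + 1) :=
  ε ((k.val + 1 : ℕ) : ZMod (d + 1))

theorem natCast_inj' {d a b : ℕ} (ha : a < d + 1) (hb : b < d + 1)
    (h : (a : ZMod (d + 1)) = b) : a = b := by
  have := congrArg ZMod.val h
  rwa [ZMod.val_natCast_of_lt ha, ZMod.val_natCast_of_lt hb] at this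

theorem range_tau {d : ℕ} [NeZero d] (ε : ZMod (d + 1) ≃ Fin (d + 1)) :
    Set.range (tau ε) = {j | j ≠ ε 0} := by
  ext x
  constructor
  · rintro ⟨k, rfl⟩ h
    have h' := ε.injective h
    have hk := ZMod.val_lt k
    have := natCast_inj' (d := d) (a := k.val + 1) (b := 0) (by omega) (by omega) (by simpa using h')
    omega
  · intro h
    obtain ⟨y, rfl⟩ := ε.surjective x
    have hy : y ≠ 0 := fun e => h (by rw [e])
    have hv : y.val ≠ 0 := fun e => hy ((ZMod.val_eq_zero y).1 e)
    have hlt := ZMod.val_lt y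
    refine ⟨((y.val - 1 : ℕ) : ZMod d), ?_⟩
    rw [tau, ZMod.val_natCast_of_lt (by omega), Nat.sub_add_cancel (by omega),
      ZMod.natCast_zmod_val]

theorem sum_pair {d : ℕ} (G : CG (d + 1)) {x y : ZMod (d + 1)} (hxy : x ≠ y)
    {x' y' : ZMod (d + 1)} (hxy' : x' ≠ y') :
    ∑ ε : ZMod (d + 1) ≃ Fin (d + 1), (G.g {ε x, ε y} : ℚ) =
      ∑ ε : ZMod (d + 1) ≃ Fin (d + 1), (G.g {ε x', ε y'} : ℚ) := by
  obtain ⟨π, hx, hy⟩ : ∃ π : Equiv.Perm (ZMod (d + 1)), π x = x' ∧ π y = y' := by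
    refine ⟨(Equiv.swap x x').trans (Equiv.swap (Equiv.swap x x' y) y'), ?_, ?_⟩
    · rw [Equiv.trans_apply, Equiv.swap_apply_left, Equiv.swap_apply_of_ne_of_ne _ hxy']
      intro h
      rw [eq_comm, Equiv.swap_apply_eq_iff, Equiv.swap_apply_right] at h
      exact hxy h.symm
    · rw [Equiv.trans_apply, Equiv.swap_apply_left]
  rw [← Equiv.sum_comp (Equiv.equivCongr π.symm (Equiv.refl _))
    (fun ε : ZMod (d + 1) ≃ Fin (d + 1) => (G.g {ε x, ε y} : ℚ))]
  subst hx hy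
  simp [Equiv.equivCongr]

theorem card_bound {d : ℕ} [NeZero d] (S R : ℕ) (G : CG (d + 1)) (hS : G.omegaG = (S : ℚ))
    (hR : (∑ i : Fin (d + 1), G.gHat i) = R) :
    Nat.card G.V ≤ 4 * d * (d + 1) * S + 2 * (d + 1) * R := by
  have hle : ∀ i, G.gHat i ≤ R := fun i => by
    rw [← hR]
    exact Finset.single_le_sum (f := fun i => G.gHat i) (fun _ _ => Nat.zero_le _)
      (Finset.mem_univ i)
  have hd0 : d ≠ 0 := NeZero.ne d
  by_cases hd : d = 1
  · subst hd
    have h1 := hle 0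
    have h2 := two_mul_g_single G 1
    have h3 : ({j | j ≠ 0} : Set (Fin 2)) = {1} := by
      ext j; fin_cases j <;> simp
    rw [gHat, h3] at h1
    omega
  have hd2 : 2 ≤ d := by omega
  have hne : ∀ k : ZMod d, (((k.val + 1 : ℕ) : ZMod (d + 1))) ≠ (((k + 1).val + 1 : ℕ)) := by
    intro k h
    have h1 := ZMod.val_lt k
    have h2 := ZMod.val_lt (k + 1)
    have h3 := natCast_inj' (by omega) (by omega) h
    have h4 : k = k + 1 := ZMod.val_injective d (by omega)
    have : Fact (1 < d) := ⟨by omega⟩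
    simp at h4
  have h01 : (0 : ZMod (d + 1)) ≠ 0 + 1 := by
    have : Fact (1 < d + 1) := ⟨by omega⟩
    simp
  set A : ℚ := ∑ ε : ZMod (d + 1) ≃ Fin (d + 1), (G.g {ε 0, ε (0 + 1)} : ℚ) with hA
  set p : ℚ := G.pQ with hp
  set f : ℚ := (Fintype.card (ZMod (d + 1) ≃ Fin (d + 1)) : ℚ) with hf
  have hf1 : 1 ≤ f := by
    rw [hf]; exact_mod_cast Fintype.card_pos
  have e1 : ∑ ε : ZMod (d + 1) ≃ Fin (d + 1), ∑ k : ZMod d,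
      (G.g {tau ε k, tau ε (k + 1)} : ℚ) = d * A := by
    rw [Finset.sum_comm]
    refine (Finset.sum_congr rfl (fun k _ => sum_pair G (hne k) h01)).trans ?_
    simp [ZMod.card, hA]
  have e2 : ∑ ε : ZMod (d + 1) ≃ Fin (d + 1), ∑ k : ZMod (d + 1),
      (G.g {ε k, ε (k + 1)} : ℚ) = (d + 1) * A := by
    have : Fact (1 < d + 1) := ⟨by omega⟩
    rw [Finset.sum_comm, Finset.sum_congr rfl
      (fun k _ => sum_pair G (x := k) (y := k + 1) (by simp) h01)]
    simp [ZMod.card, hA]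
  have hV : (Nat.card G.V : ℚ) = 2 * p := by rw [hp, pQ]; ring
  have i1 : d * A ≤ f * (2 * R + (d - 2) * p) := by
    rw [← e1, hf, ← nsmul_eq_mul, ← Finset.card_univ]
    refine Finset.sum_le_card_nsmul _ _ _ ?_
    intro ε _
    have h1 := genus_nonneg G (tau ε)
    rw [range_tau] at h1
    have h2 := hle (ε 0)
    rw [gHat] at h2
    have h3 : 2 * (∑ j : ZMod d, G.g {tau ε j, tau ε (j + 1)}) + 2 * Nat.card G.V ≤
      4 * R + d * Nat.card G.V := by omega
    have h4 : 2 * (∑ j : ZMod d, (G.g {tau ε j, tau ε (j + 1)} : ℚ)) + 2 * Nat.card G.V ≤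
      4 * R + d * Nat.card G.V := by exact_mod_cast h3
    rw [hV] at h4
    linarith
  have e3 : 2 * ((d : ℚ) + 1) * S = f - ((d + 1) * A + f * ((1 - d) * p)) / 2 := by
    rw [← hS, omegaG]
    have : ∑ ε : ZMod (d + 1) ≃ Fin (d + 1), G.rho ε =
        f - ((d + 1) * A + f * ((1 - d) * p)) / 2 := by
      simp only [rho]
      rw [Finset.sum_sub_distrib, ← Finset.sum_div, Finset.sum_add_distrib, e2]
      simp only [Finset.sum_const, Finset.card_univ, nsmul_eq_mul, ← hf, ← hp]
      push_cast
      ring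
    rw [this]
    push_cast
    have : (d : ℚ) + 1 ≠ 0 := by positivity
    field_simp
  have hdpos : (0 : ℚ) < d := by positivity
  have i2 : ((d : ℚ) + 1) * (d * A) ≤ (d + 1) * (f * (2 * R + (d - 2) * p)) :=
    mul_le_mul_of_nonneg_left i1 (by positivity)
  have i3 : f * (2 * p) ≤ 4 * d * (d + 1) * S + f * (2 * (d + 1) * R) := by
    have e4 : (d : ℚ) * (2 * ((d : ℚ) + 1) * S) =
      d * (f - ((d + 1) * A + f * ((1 - d) * p)) / 2) := by rw [e3]
    nlinarith [mul_pos hdpos (lt_of_lt_of_le one_pos hf1)]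
  have i4 : f * (2 * p) ≤ f * (4 * d * (d + 1) * S + 2 * (d + 1) * R) := by
    have : (0 : ℚ) ≤ (f - 1) * (4 * d * (d + 1) * S) :=
      mul_nonneg (by linarith) (by positivity)
    nlinarith
  have i5 := le_of_mul_le_mul_left i4 (by linarith)
  rw [← hV] at i5
  exact_mod_cast i5

end CG

/-- for fixed `S ≥ 0` and `R ≥ d+1` there are only finitely many
`(d+1)`-colored graphs (up to isomorphism) with Gurau degree `S` and `Σ_i g_{î} = R`. -/
theorem finitely_many_graphs_of_fixed_degree {d : ℕ} [NeZero d] (S R : ℕ)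
    (hR : d + 1 ≤ R) :
    ∃ (m : ℕ) (F : Fin m → CG (d + 1)),
      ∀ G : CG (d + 1), G.Connected → G.omegaG = (S : ℚ) →
        (∑ i : Fin (d + 1), G.gHat i) = R → ∃ k, CG.Iso G (F k) := by
  classical
  let N := 4 * d * (d + 1) * S + 2 * (d + 1) * R
  let T := Σ k : Fin (N + 1), {f : Fin (d + 1) → Fin k → Fin k //
    (∀ i v, f i (f i v) = v) ∧ ∀ i v, f i v ≠ v}
  have : Finite T := inferInstance
  obtain ⟨m, ⟨e⟩⟩ := Finite.exists_equiv_fin T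
  let toG : T → CG (d + 1) := fun t =>
    { V := Fin t.1, inv := t.2.1, invol := t.2.2.1, noFix := t.2.2.2 }
  refine ⟨m, fun k => toG (e.symm k), ?_⟩
  intro G _ hS hRG
  have hN : Nat.card G.V ≤ N := CG.card_bound S R G hS hRG
  let φ : G.V ≃ Fin (Nat.card G.V) := Finite.equivFin G.V
  let t : T := ⟨⟨Nat.card G.V, by omega⟩, fun i v => φ (G.inv i (φ.symm v)),
    fun i v => by simp [G.invol], fun i v h => G.noFix i (φ.symm v) (by
      apply φ.injective; exact h.trans (φ.apply_symm_apply v).symm)⟩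
  refine ⟨e t, ?_⟩
  simp only [Equiv.symm_apply_apply]
  exact ⟨φ, fun i v => by simp [toG, t]⟩
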